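/- arXiv:1609.04801 — 4 statements merged into one kernel-verified Lean document; each statement's English description precedes it below -/
import Mathlib

section
/- For all integers n ≥ 2 and d ≥ 2 and every integer k with n < k and 2k ≤ nd, one has the strict inequality γ_{n,d,k−1} < γ_{n,d,k}. -/
/-- coefficients of `(1 + x + ... + x^m)^n`, indexed by integers -/
def cc (m : ℕ) : ℕ → ℤ → ℤ
  | 0, j => if j = 0 then 1 else 0
  | n + 1, j => ∑ i ∈ Finset.range (m + 1), cc m n (j - (i : ℤ))

theorem cc_neg (m n : ℕ) : ∀ j : ℤ, j < 0 → cc m n j = 0 := by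
  induction n with
  | zero => intro j hj; simp only [cc]; rw [if_neg (by omega)]
  | succ n ih =>
    intro j hj
    simp only [cc]
    exact Finset.sum_eq_zero fun i _ => ih _ (by omega)

theorem cc_symm (m n : ℕ) : ∀ j : ℤ, cc m n ((n : ℤ) * m - j) = cc m n j := by
  induction n with
  | zero =>
    intro j
    simp [cc]
  | succ n ih =>
    intro j
    simp only [cc]
    rw [← Finset.sum_range_reflect]
    refine Finset.sum_congr rfl fun i hi => ?_
    rw [← ih]
    congr 1
    have : i ≤ m := by simp at hi; omega
    have h : ((m + 1 - 1 - i : ℕ) : ℤ) = m - i := by omega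
    rw [h]; push_cast; ring

theorem cc_diff (m n : ℕ) (j : ℤ) :
    cc m (n + 1) j - cc m (n + 1) (j - 1) = cc m n j - cc m n (j - m - 1) := by
  simp only [cc]
  rw [Finset.sum_range_succ', Finset.sum_range_succ]
  have : ∑ i ∈ Finset.range m, cc m n (j - ((i + 1 : ℕ) : ℤ)) =
      ∑ i ∈ Finset.range m, cc m n (j - 1 - (i : ℤ)) := by
    refine Finset.sum_congr rfl fun i _ => ?_
    congr 1; push_cast; ring
  rw [this, show j - 1 - (m : ℤ) = j - m - 1 by ring]
  simp

theorem cc_one (m : ℕ) (j : ℤ) (h0 : 0 ≤ j) (h1 : j ≤ m) : cc m 1 j = 1 := by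
  simp only [cc]
  rw [Finset.sum_eq_single j.toNat]
  · rw [if_pos (by omega)]
  · intro b _ hb
    rw [if_neg (by omega)]
  · intro h
    simp at h
    omega

theorem cc_half (m n : ℕ) (S : ∀ j : ℤ, 0 ≤ j → 2 * j ≤ n * m → cc m n (j - 1) < cc m n j)
    (a b : ℤ) (ha : -1 ≤ a) (hab : a < b) (hb : 2 * b ≤ n * m) : cc m n a < cc m n b := by
  have key : ∀ b : ℤ, a + 1 ≤ b → 2 * b ≤ n * m → cc m n a < cc m n b := by
    intro b hb
    induction b, hb using Int.le_induction with
    | base =>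
      intro h
      have := S (a + 1) (by omega) h
      simpa using this
    | succ b hb ih =>
      intro h
      have h1 := S (b + 1) (by omega) h
      have h2 := ih (by linarith)
      simp only [add_sub_cancel_right] at h1
      exact h2.trans h1
  exact key b hab hb

theorem cc_full (m n : ℕ) (S : ∀ j : ℤ, 0 ≤ j → 2 * j ≤ n * m → cc m n (j - 1) < cc m n j)
    (a b : ℤ) (hab : a < b) (hb0 : 0 ≤ b) (hb : b ≤ n * m) (hs : a + b < n * m) :
    cc m n a < cc m n b := by
  have key : ∀ a : ℤ, -1 ≤ a → a < b → a + b < n * m → cc m n a < cc m n b := by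
    intro a ha hab hs
    by_cases h : 2 * b ≤ n * m
    · exact cc_half m n S a b ha hab h
    · rw [← cc_symm m n b]
      exact cc_half m n S a _ ha (by linarith) (by linarith)
  by_cases ha : -1 ≤ a
  · exact key a ha hab hs
  · rw [cc_neg m n a (by omega), ← cc_neg m n (-1) (by omega)]
    exact key (-1) le_rfl (by omega) (by linarith)

theorem cc_strict (m n : ℕ) :
    ∀ j : ℤ, 0 ≤ j → 2 * j ≤ ((n + 2 : ℕ) : ℤ) * m → cc m (n + 2) (j - 1) < cc m (n + 2) j := by
  induction n with
  | zero =>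
    intro j h0 h1
    have h := cc_diff m 1 j
    push_cast at h1
    rw [cc_one m j h0 (by linarith), cc_neg m 1 (j - m - 1) (by linarith)] at h
    simp only [zero_add, Nat.reduceAdd] at *
    linarith
  | succ n ih =>
    intro j h0 h1
    have h := cc_diff m (n + 2) j
    have hm : (0 : ℤ) ≤ m := by positivity
    have hnm : (0 : ℤ) ≤ (n : ℤ) * m := by positivity
    push_cast at h1
    have := cc_full m (n + 2) ih (j - m - 1) j (by linarith) h0
      (by push_cast; nlinarith) (by push_cast; nlinarith)
    rw [show n + 1 + 2 = n + 2 + 1 by ring]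
    linarith

theorem coeff_cc (m n : ℕ) : ∀ k : ℕ,
    ((∑ i ∈ Finset.Ico 1 (m + 2), (Polynomial.X : Polynomial ℤ) ^ i) ^ n).coeff k =
      cc m n ((k : ℤ) - n) := by
  induction n with
  | zero =>
    intro k
    simp [cc, Polynomial.coeff_one]
  | succ n ih =>
    intro k
    rw [pow_succ, Finset.mul_sum, Polynomial.finsetSum_coeff, Finset.sum_Ico_eq_sum_range]
    simp only [cc]
    refine Finset.sum_congr rfl fun i _ => ?_
    rw [Polynomial.coeff_mul_X_pow']
    split_ifs with h
    · rw [ih]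
      congr 1
      omega
    · rw [cc_neg]
      omega

/-- For integers `n ≥ 2`, `d ≥ 2` and `k` with `n < k` and `2k ≤ nd`, the coefficient
`γ_{n,d,k-1}` of `t^(k-1)` in `(t + t^2 + ⋯ + t^(d-1))^n` is strictly smaller than the
coefficient `γ_{n,d,k}` of `t^k`. -/
theorem gamma_strict_mono (n d k : ℕ) (hn : 2 ≤ n) (hd : 2 ≤ d)
    (hk : n < k) (hk2 : 2 * k ≤ n * d) :
    ((∑ i ∈ Finset.Ico 1 d, (Polynomial.X : Polynomial ℤ) ^ i) ^ n).coeff (k - 1) <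
      ((∑ i ∈ Finset.Ico 1 d, (Polynomial.X : Polynomial ℤ) ^ i) ^ n).coeff k := by
  obtain ⟨m, rfl⟩ : ∃ m, d = m + 2 := ⟨d - 2, by omega⟩
  obtain ⟨p, rfl⟩ : ∃ p, n = p + 2 := ⟨n - 2, by omega⟩
  rw [coeff_cc, coeff_cc]
  have h := cc_strict m p ((k : ℤ) - (p + 2 : ℕ)) (by omega) (by
    zify at hk2
    push_cast
    nlinarith)
  convert h using 2
  omega
end

section
/- Let h ∈ ℂ[x_1, …, x_n] be weighted homogeneous of weighted degree m with respect to weights m_1, …, m_n, and suppose its Milnor algebra Q(h) is finite-dimensional over ℂ. Then (∏_{i=1}^n m_i) · dim_ℂ Q(h) = ∏_{i=1}^n (m − m_i) (an equality of integers). In particular dim_ℂ Q(h) = ∏_{i=1}^n (1/w_i − 1) where w_i = m_i/m. -/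
open MvPolynomial

/-- The Jacobian ideal of `h`, generated by its partial derivatives. -/
noncomputable def jacobianIdeal (n : ℕ) (h : MvPolynomial (Fin n) ℂ) :
    Ideal (MvPolynomial (Fin n) ℂ) :=
  Ideal.span (Set.range fun i => MvPolynomial.pderiv i h)

/-- The Milnor algebra `Q(h) = ℂ[x_1,…,x_n]/(∂h/∂x_1,…,∂h/∂x_n)`. -/
noncomputable abbrev milnorAlgebra (n : ℕ) (h : MvPolynomial (Fin n) ℂ) :=
  MvPolynomial (Fin n) ℂ ⧸ jacobianIdeal n h


section MilnorAux
attribute [local instance] MvPolynomial.weightedGradedAlgebra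

lemma aux_comp_mul {n : ℕ} (w : Fin n → ℕ) {f : MvPolynomial (Fin n) ℂ} {d : ℕ}
    (hf : IsWeightedHomogeneous w f d) (c : MvPolynomial (Fin n) ℂ) (t : ℕ) :
    weightedHomogeneousComponent w t (f * c) =
      if d ≤ t then f * weightedHomogeneousComponent w (t - d) c else 0 := by
  have := DirectSum.coe_decompose_mul_of_left_mem
    (𝒜 := weightedHomogeneousSubmodule ℂ w) (i := d) (b := c) t hf
  simp only [← weightedDecomposition.decompose'_apply]
  exact this

lemma aux_homog_span {n : ℕ} (w : Fin n → ℕ) (s : Set (MvPolynomial (Fin n) ℂ))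
    (h : ∀ f ∈ s, ∃ d, IsWeightedHomogeneous w f d) (p : MvPolynomial (Fin n) ℂ)
    (hp : p ∈ Ideal.span s) (t : ℕ) : weightedHomogeneousComponent w t p ∈ Ideal.span s :=
  weightedHomogeneousComponent_mem_of_mem ℂ w
    (Ideal.homogeneous_span (weightedHomogeneousSubmodule ℂ w) s h) hp t
end MilnorAux

/-- graded piece of the quotient -/
noncomputable def grPiece {n : ℕ} (w : Fin n → ℕ) (I : Ideal (MvPolynomial (Fin n) ℂ)) (t : ℕ) :
    Submodule ℂ (MvPolynomial (Fin n) ℂ ⧸ I) :=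
  (weightedHomogeneousSubmodule ℂ w t).map (Ideal.Quotient.mkₐ ℂ I).toLinearMap

/-- Hilbert function -/
noncomputable def hilbF {n : ℕ} (w : Fin n → ℕ) (I : Ideal (MvPolynomial (Fin n) ℂ)) (t : ℕ) : ℕ :=
  Module.finrank ℂ (grPiece w I t)

lemma grPiece_fin {n : ℕ} {w : Fin n → ℕ} (hw : ∀ i, 0 < w i)
    (I : Ideal (MvPolynomial (Fin n) ℂ)) (t : ℕ) : FiniteDimensional ℂ (grPiece w I t) := by
  apply Module.Finite.iff_fg.mpr
  exact (weightedHomogeneousSubmodule_fg ℂ w (fun i => (hw i).ne') t).map _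

lemma mem_grPiece {n : ℕ} {w : Fin n → ℕ}
    {I : Ideal (MvPolynomial (Fin n) ℂ)} {t : ℕ} {q : MvPolynomial (Fin n) ℂ ⧸ I} :
    q ∈ grPiece w I t ↔ ∃ p, IsWeightedHomogeneous w p t ∧ Ideal.Quotient.mk I p = q := by
  simp [grPiece, Submodule.mem_map, mem_weightedHomogeneousSubmodule]

lemma finrank_map_ker {V W : Type*} [AddCommGroup V] [Module ℂ V] [AddCommGroup W] [Module ℂ W]
    (φ : V →ₗ[ℂ] W) (M : Submodule ℂ V) [FiniteDimensional ℂ M] :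
    Module.finrank ℂ (M.map φ) + Module.finrank ℂ (M ⊓ LinearMap.ker φ : Submodule ℂ V)
      = Module.finrank ℂ M := by
  have h := LinearMap.finrank_range_add_finrank_ker (φ.domRestrict M)
  rw [LinearMap.range_domRestrict] at h
  rw [← h]
  congr 1
  have : (M ⊓ LinearMap.ker φ : Submodule ℂ V) = (LinearMap.ker (φ.domRestrict M)).map M.subtype := by
    ext x; simp [Submodule.mem_map, and_comm]
  rw [this, Submodule.finrank_map_subtype_eq]

/-- `f` is a nonzerodivisor modulo `I` on degree `t` elements -/
def NzdAt {n : ℕ} (w : Fin n → ℕ) (I : Ideal (MvPolynomial (Fin n) ℂ))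
    (f : MvPolynomial (Fin n) ℂ) (t : ℕ) : Prop :=
  ∀ u, IsWeightedHomogeneous w u t → f * u ∈ I → u ∈ I

lemma hilb_step {n : ℕ} {w : Fin n → ℕ} (hw : ∀ i, 0 < w i)
    (I : Ideal (MvPolynomial (Fin n) ℂ))
    (hI : ∀ p ∈ I, ∀ t, weightedHomogeneousComponent w t p ∈ I)
    (f : MvPolynomial (Fin n) ℂ) (d : ℕ) (hf : IsWeightedHomogeneous w f d) (t : ℕ) :
    ∃ k, hilbF w (I ⊔ Ideal.span {f}) (t + d) + hilbF w I t = hilbF w I (t + d) + k ∧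
      (k = 0 ↔ NzdAt w I f t) := by
  have := grPiece_fin hw I t
  have := grPiece_fin hw I (t+d)
  set J := I ⊔ Ideal.span {f} with hJ
  let φ : (MvPolynomial (Fin n) ℂ ⧸ I) →ₗ[ℂ] (MvPolynomial (Fin n) ℂ ⧸ I) :=
    LinearMap.mulLeft ℂ (Ideal.Quotient.mk I f)
  let π : (MvPolynomial (Fin n) ℂ ⧸ I) →ₗ[ℂ] (MvPolynomial (Fin n) ℂ ⧸ J) :=
    (Ideal.Quotient.factorₐ ℂ (le_sup_left : I ≤ J)).toLinearMap
  have h1 := finrank_map_ker φ (grPiece w I t)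
  have h2 := finrank_map_ker π (grPiece w I (t+d))
  have e1 : (grPiece w I (t+d)).map π = grPiece w J (t+d) := by
    ext q
    simp only [Submodule.mem_map, mem_grPiece]
    constructor
    · rintro ⟨_, ⟨p, hp, rfl⟩, rfl⟩
      exact ⟨p, hp, rfl⟩
    · rintro ⟨p, hp, rfl⟩
      exact ⟨_, ⟨p, hp, rfl⟩, rfl⟩
  have e2 : grPiece w I (t+d) ⊓ LinearMap.ker π = (grPiece w I t).map φ := by
    ext q
    simp only [Submodule.mem_map, mem_grPiece, Submodule.mem_inf, LinearMap.mem_ker]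
    constructor
    · rintro ⟨⟨p, hp, rfl⟩, h0⟩
      have h0 : p ∈ J := Ideal.Quotient.eq_zero_iff_mem.mp h0
      obtain ⟨a, ha, b, hb, rfl⟩ := Submodule.mem_sup.mp h0
      obtain ⟨c, rfl⟩ := Ideal.mem_span_singleton.mp hb
      refine ⟨_, ⟨weightedHomogeneousComponent w t c,
        weightedHomogeneousComponent_isWeightedHomogeneous _ _, rfl⟩, ?_⟩
      have h3 := weightedHomogeneousComponent_eq_self hp
      rw [map_add, aux_comp_mul w hf, if_pos (by omega), Nat.add_sub_cancel] at h3
      have h4 := hI a ha (t+d)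
      rw [← h3]
      simp only [φ, LinearMap.mulLeft_apply, map_add, map_mul]
      rw [Ideal.Quotient.eq_zero_iff_mem.mpr h4, zero_add]
    · rintro ⟨_, ⟨p, hp, rfl⟩, rfl⟩
      refine ⟨⟨f * p, by rw [add_comm]; exact hf.mul hp, by simp [φ]⟩, ?_⟩
      have : Ideal.Quotient.mk J (f * p) = 0 := by
        rw [Ideal.Quotient.eq_zero_iff_mem]
        exact Ideal.mul_mem_right _ _ (Ideal.mem_sup_right (Ideal.mem_span_singleton_self f))
      rw [map_mul] at this
      simpa [φ, π] using this
  rw [e1, e2] at h2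
  refine ⟨Module.finrank ℂ (grPiece w I t ⊓ LinearMap.ker φ : Submodule ℂ _), ?_, ?_⟩
  · unfold hilbF; omega
  · have : FiniteDimensional ℂ (grPiece w I t ⊓ LinearMap.ker φ : Submodule ℂ _) :=
      Submodule.finiteDimensional_inf_left _ _
    rw [Submodule.finrank_eq_zero, Submodule.eq_bot_iff]
    constructor
    · intro h u hu hfu
      rw [← Ideal.Quotient.eq_zero_iff_mem]
      apply h
      refine ⟨mem_grPiece.mpr ⟨u, hu, rfl⟩, ?_⟩
      rw [← Ideal.Quotient.eq_zero_iff_mem, map_mul] at hfu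
      simpa [φ] using hfu
    · rintro h q ⟨hq, hk⟩
      obtain ⟨u, hu, rfl⟩ := mem_grPiece.mp hq
      rw [Ideal.Quotient.eq_zero_iff_mem]
      apply h u hu
      rw [← Ideal.Quotient.eq_zero_iff_mem, map_mul]
      simpa [φ] using hk

lemma hilb_low {n : ℕ} {w : Fin n → ℕ} (hw : ∀ i, 0 < w i)
    (I : Ideal (MvPolynomial (Fin n) ℂ))
    (hI : ∀ p ∈ I, ∀ t, weightedHomogeneousComponent w t p ∈ I)
    (f : MvPolynomial (Fin n) ℂ) (d : ℕ) (hf : IsWeightedHomogeneous w f d) (t : ℕ) (ht : t < d) :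
    hilbF w (I ⊔ Ideal.span {f}) t = hilbF w I t := by
  have := grPiece_fin hw I t
  set J := I ⊔ Ideal.span {f} with hJ
  let π : (MvPolynomial (Fin n) ℂ ⧸ I) →ₗ[ℂ] (MvPolynomial (Fin n) ℂ ⧸ J) :=
    (Ideal.Quotient.factorₐ ℂ (le_sup_left : I ≤ J)).toLinearMap
  have h2 := finrank_map_ker π (grPiece w I t)
  have e1 : (grPiece w I t).map π = grPiece w J t := by
    ext q
    simp only [Submodule.mem_map, mem_grPiece]
    constructor
    · rintro ⟨_, ⟨p, hp, rfl⟩, rfl⟩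
      exact ⟨p, hp, rfl⟩
    · rintro ⟨p, hp, rfl⟩
      exact ⟨_, ⟨p, hp, rfl⟩, rfl⟩
  have e2 : grPiece w I t ⊓ LinearMap.ker π = ⊥ := by
    rw [Submodule.eq_bot_iff]
    rintro q ⟨hq, h0⟩
    obtain ⟨p, hp, rfl⟩ := mem_grPiece.mp hq
    have h0 : p ∈ J := Ideal.Quotient.eq_zero_iff_mem.mp h0
    obtain ⟨a, ha, b, hb, rfl⟩ := Submodule.mem_sup.mp h0
    obtain ⟨c, rfl⟩ := Ideal.mem_span_singleton.mp hb
    have h3 := weightedHomogeneousComponent_eq_self hp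
    rw [map_add, aux_comp_mul w hf, if_neg (by omega), add_zero] at h3
    rw [← h3]
    exact Ideal.Quotient.eq_zero_iff_mem.mpr (hI a ha t)
  rw [e1, e2, finrank_bot] at h2
  exact h2


/-- Hilbert series -/
noncomputable def hilbS {n : ℕ} (w : Fin n → ℕ) (I : Ideal (MvPolynomial (Fin n) ℂ)) :
    PowerSeries ℤ := PowerSeries.mk (fun t => (hilbF w I t : ℤ))

/-- nonnegative coefficients -/
def NNs (p : PowerSeries ℤ) : Prop := ∀ t, 0 ≤ PowerSeries.coeff t p

lemma NNs.mul {p q : PowerSeries ℤ} (hp : NNs p) (hq : NNs q) : NNs (p * q) := by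
  intro t
  rw [PowerSeries.coeff_mul]
  exact Finset.sum_nonneg fun x _ => mul_nonneg (hp _) (hq _)

lemma NNs.add {p q : PowerSeries ℤ} (hp : NNs p) (hq : NNs q) : NNs (p + q) := by
  intro t
  rw [map_add]
  exact add_nonneg (hp _) (hq _)

lemma NNs.eq_zero {p q : PowerSeries ℤ} (hp : NNs p) (hq : NNs q) (h : p + q = 0) :
    p = 0 ∧ q = 0 := by
  have : ∀ t, PowerSeries.coeff t p = 0 ∧ PowerSeries.coeff t q = 0 := by
    intro t
    have := congrArg (PowerSeries.coeff t) h
    rw [map_add, map_zero] at this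
    have := hp t
    have := hq t
    constructor <;> linarith
  exact ⟨PowerSeries.ext fun t => by simpa using (this t).1,
    PowerSeries.ext fun t => by simpa using (this t).2⟩

lemma exists_geom (d : ℕ) (hd : 0 < d) :
    ∃ G : PowerSeries ℤ, NNs G ∧ (1 - PowerSeries.X ^ d) * G = 1 := by
  refine ⟨PowerSeries.mk fun t => if d ∣ t then 1 else 0, ?_, ?_⟩
  · intro t
    rw [PowerSeries.coeff_mk]
    split_ifs <;> norm_num
  · ext t
    rw [sub_mul, one_mul, map_sub, PowerSeries.coeff_X_pow_mul', PowerSeries.coeff_one]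
    simp only [PowerSeries.coeff_mk]
    by_cases h : d ≤ t
    · have : t ≠ 0 := by omega
      simp [h, this, Nat.dvd_sub_self_right]
      by_cases h2 : d ∣ t
      · simp [h2]
      · have : t ≠ d := by
          rintro rfl
          exact h2 dvd_rfl
        simp [h2]
        omega
    · rcases Nat.eq_zero_or_pos t with rfl | h0
      · simp
        try omega
      · have : ¬ d ∣ t := fun h2 => h (Nat.le_of_dvd h0 h2)
        simp [h, this, h0.ne']

lemma hilbS_step {n : ℕ} {w : Fin n → ℕ} (hw : ∀ i, 0 < w i)
    (I : Ideal (MvPolynomial (Fin n) ℂ))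
    (hI : ∀ p ∈ I, ∀ t, weightedHomogeneousComponent w t p ∈ I)
    (f : MvPolynomial (Fin n) ℂ) (d : ℕ) (hf : IsWeightedHomogeneous w f d) :
    ∃ E, NNs E ∧ hilbS w (I ⊔ Ideal.span {f}) = (1 - PowerSeries.X ^ d) * hilbS w I + E ∧
      (E = 0 ↔ ∀ t, NzdAt w I f t) := by
  choose k hk1 hk2 using hilb_step hw I hI f d hf
  refine ⟨PowerSeries.X ^ d * PowerSeries.mk fun t => (k t : ℤ), ?_, ?_, ?_⟩
  · intro t
    rw [PowerSeries.coeff_X_pow_mul']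
    split_ifs <;> simp
  · ext t
    rw [sub_mul, one_mul, map_add, map_sub, PowerSeries.coeff_X_pow_mul',
      PowerSeries.coeff_X_pow_mul']
    simp only [hilbS, PowerSeries.coeff_mk]
    split_ifs with h
    · obtain ⟨s, rfl⟩ := Nat.exists_eq_add_of_le' h
      have := hk1 s
      rw [Nat.add_sub_cancel]
      omega
    · rw [hilb_low hw I hI f d hf t (by omega)]
      ring
  · simp only [← hk2]
    constructor
    · intro h t
      have := congrArg (PowerSeries.coeff (t + d)) h
      rw [PowerSeries.coeff_X_pow_mul'] at this
      simpa using this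
    · intro h
      ext t
      rw [PowerSeries.coeff_X_pow_mul']
      simp [h]

/-- ideal generated by subfamily -/
noncomputable def subIdeal {n : ℕ} (A : Fin n → MvPolynomial (Fin n) ℂ) (S : Finset (Fin n)) :
    Ideal (MvPolynomial (Fin n) ℂ) := Ideal.span (A '' (S : Set (Fin n)))

lemma subIdeal_insert {n : ℕ} (A : Fin n → MvPolynomial (Fin n) ℂ) (S : Finset (Fin n)) (k : Fin n) :
    subIdeal A (insert k S) = subIdeal A S ⊔ Ideal.span {A k} := by
  rw [subIdeal, subIdeal, Finset.coe_insert, Set.image_insert_eq, Ideal.span_insert, sup_comm]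

lemma subIdeal_univ {n : ℕ} (A : Fin n → MvPolynomial (Fin n) ℂ) :
    subIdeal A Finset.univ = Ideal.span (Set.range A) := by
  simp [subIdeal]

lemma subIdeal_update {n : ℕ} (A : Fin n → MvPolynomial (Fin n) ℂ) (k : Fin n)
    (b : MvPolynomial (Fin n) ℂ) :
    subIdeal (Function.update A k b) (Finset.univ.erase k) = subIdeal A (Finset.univ.erase k) := by
  unfold subIdeal
  congr 1
  apply Set.image_congr
  intro i hi
  have : i ≠ k := by simpa using hi
  simp [this]

lemma span_eq {n : ℕ} (A : Fin n → MvPolynomial (Fin n) ℂ) (k : Fin n) :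
    Ideal.span (Set.range A) = subIdeal A (Finset.univ.erase k) ⊔ Ideal.span {A k} := by
  rw [← subIdeal_univ, ← subIdeal_insert, Finset.insert_erase (Finset.mem_univ k)]

lemma span_update {n : ℕ} (A : Fin n → MvPolynomial (Fin n) ℂ) (k : Fin n)
    (b : MvPolynomial (Fin n) ℂ) :
    Ideal.span (Set.range (Function.update A k b)) =
      subIdeal A (Finset.univ.erase k) ⊔ Ideal.span {b} := by
  rw [span_eq _ k, subIdeal_update, Function.update_self]

lemma subIdeal_homog {n : ℕ} {w : Fin n → ℕ} {A : Fin n → MvPolynomial (Fin n) ℂ} {d : Fin n → ℕ}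
    (hA : ∀ i, IsWeightedHomogeneous w (A i) (d i)) (S : Finset (Fin n)) :
    ∀ p ∈ subIdeal A S, ∀ t, weightedHomogeneousComponent w t p ∈ subIdeal A S := by
  intro p hp t
  refine aux_homog_span w _ ?_ p hp t
  rintro _ ⟨i, _, rfl⟩
  exact ⟨_, hA i⟩

lemma hilb_chain {n : ℕ} {w : Fin n → ℕ} (hw : ∀ i, 0 < w i)
    {A : Fin n → MvPolynomial (Fin n) ℂ} {d : Fin n → ℕ}
    (hA : ∀ i, IsWeightedHomogeneous w (A i) (d i))
    (G : Fin n → PowerSeries ℤ) (hG : ∀ i, NNs (G i))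
    (hG1 : ∀ i, (1 - PowerSeries.X ^ (d i)) * G i = 1) (S : Finset (Fin n)) :
    NNs (∏ i ∈ S, G i) ∧
    ∃ E, NNs E ∧ hilbS w (subIdeal A S) * ∏ i ∈ S, G i = hilbS w ⊥ + E := by
  induction S using Finset.induction_on with
  | empty =>
    refine ⟨?_, 0, fun t => by simp, by simp [subIdeal]⟩
    intro t
    simp only [Finset.prod_empty, PowerSeries.coeff_one]
    split_ifs <;> norm_num
  | insert k S hk ih =>
    obtain ⟨h1, E, hE, h2⟩ := ih
    rw [Finset.prod_insert hk]
    have h3 := (hG k).mul h1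
    refine ⟨h3, ?_⟩
    obtain ⟨E', hE', h4, -⟩ := hilbS_step hw (subIdeal A S) (subIdeal_homog hA S) (A k) (d k) (hA k)
    refine ⟨E + E' * (G k * ∏ i ∈ S, G i), hE.add (hE'.mul h3), ?_⟩
    rw [subIdeal_insert, h4]
    linear_combination h2 + (hilbS w (subIdeal A S) * ∏ i ∈ S, G i) * hG1 k

/-- the Hilbert series is that of a complete intersection -/
def GoodF {n : ℕ} (w : Fin n → ℕ) (A : Fin n → MvPolynomial (Fin n) ℂ) (d : Fin n → ℕ) : Prop :=
  hilbS w (Ideal.span (Set.range A)) = (∏ i, (1 - PowerSeries.X ^ (d i))) * hilbS w ⊥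

lemma GoodF.nzd {n : ℕ} {w : Fin n → ℕ} (hw : ∀ i, 0 < w i)
    {A : Fin n → MvPolynomial (Fin n) ℂ} {d : Fin n → ℕ}
    (hA : ∀ i, IsWeightedHomogeneous w (A i) (d i)) (hd : ∀ i, 0 < d i)
    (h : GoodF w A d) (k : Fin n) :
    (∀ t, NzdAt w (subIdeal A (Finset.univ.erase k)) (A k) t) ∧
    hilbS w (subIdeal A (Finset.univ.erase k)) =
      (∏ i ∈ Finset.univ.erase k, (1 - PowerSeries.X ^ (d i))) * hilbS w ⊥ := by
  choose G hG hG1 using fun i => exists_geom (d i) (hd i)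
  obtain ⟨h1, E, hE, h2⟩ := hilb_chain hw hA G hG hG1 (Finset.univ.erase k)
  obtain ⟨E', hE', h4, h5⟩ := hilbS_step hw _ (subIdeal_homog hA (Finset.univ.erase k))
    (A k) (d k) (hA k)
  rw [← span_eq, h] at h4
  have hp : (∏ i ∈ Finset.univ.erase k, (1 - (PowerSeries.X : PowerSeries ℤ) ^ (d i))) *
      ∏ i ∈ Finset.univ.erase k, G i = 1 := by
    rw [← Finset.prod_mul_distrib]
    exact Finset.prod_eq_one fun i _ => hG1 i
  rw [← Finset.mul_prod_erase Finset.univ _ (Finset.mem_univ k)] at h4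
  set P := ∏ i ∈ Finset.univ.erase k, (1 - (PowerSeries.X : PowerSeries ℤ) ^ (d i))
  set Q := ∏ i ∈ Finset.univ.erase k, G i
  have hk := hG1 k
  set x := 1 - (PowerSeries.X : PowerSeries ℤ) ^ (d k)
  have key : E + E' * (G k * Q) = 0 := by
    linear_combination (hilbS w ⊥ - hilbS w (subIdeal A (Finset.univ.erase k)) * Q) * hk
      + x * G k * hilbS w ⊥ * hp - G k * Q * h4 - h2
  obtain ⟨e1, e2⟩ := hE.eq_zero (hE'.mul ((hG k).mul h1)) key
  constructor
  · rw [← h5]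
    linear_combination (x * P) * e2 - E' * P * Q * hk - E' * hp
  · rw [e1] at h2
    linear_combination P * h2 - hilbS w (subIdeal A (Finset.univ.erase k)) * hp

/-- system of parameters -/
def SopF {n : ℕ} (I : Ideal (MvPolynomial (Fin n) ℂ)) : Prop := ∀ i, X i ∈ I.radical

lemma SopF.mem {n : ℕ} {w : Fin n → ℕ} {I : Ideal (MvPolynomial (Fin n) ℂ)} (h : SopF I)
    {a : MvPolynomial (Fin n) ℂ} {d : ℕ} (ha : IsWeightedHomogeneous w a d) (hd : 0 < d) :
    a ∈ I.radical := by
  have h1 : Ideal.span (X '' (Set.univ : Set (Fin n))) ≤ I.radical := by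
    rw [Ideal.span_le]
    rintro _ ⟨i, -, rfl⟩
    exact h i
  apply h1
  rw [mem_ideal_span_X_image]
  intro m hm
  by_contra hc
  push Not at hc
  have : m = 0 := by ext i; simpa using hc i
  have h2 := ha (mem_support_iff.mp hm)
  rw [this] at h2
  simp at h2
  omega

lemma GoodF.exchange {n : ℕ} {w : Fin n → ℕ} (hw : ∀ i, 0 < w i)
    {A : Fin n → MvPolynomial (Fin n) ℂ} {d : Fin n → ℕ}
    (hA : ∀ i, IsWeightedHomogeneous w (A i) (d i)) (hd : ∀ i, 0 < d i)
    (h : GoodF w A d) (k : Fin n) (b : MvPolynomial (Fin n) ℂ) (e : ℕ)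
    (hb : IsWeightedHomogeneous w b e)
    (hs : SopF (Ideal.span (Set.range (Function.update A k b)))) :
    GoodF w (Function.update A k b) (Function.update d k e) := by
  obtain ⟨h1, h2⟩ := h.nzd hw hA hd k
  obtain ⟨E', hE', h4, h5⟩ := hilbS_step hw _ (subIdeal_homog hA (Finset.univ.erase k)) b e hb
  rw [span_update] at hs
  have h6 : E' = 0 := by
    rw [h5]
    intro t u hu hbu
    obtain ⟨N, hN⟩ := hs.mem (hA k) (hd k)
    have h7 : A k ^ N * u ∈ subIdeal A (Finset.univ.erase k) := by
      obtain ⟨x, hx, y, hy, hxy⟩ := Submodule.mem_sup.mp hN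
      obtain ⟨c, rfl⟩ := Ideal.mem_span_singleton.mp hy
      rw [← hxy, add_mul]
      refine Ideal.add_mem _ (Ideal.mul_mem_right _ _ hx) ?_
      have : b * c * u = c * (b * u) := by ring
      rw [this]
      exact Ideal.mul_mem_left _ _ hbu
    clear hN
    induction N with
    | zero => simpa using h7
    | succ N ih =>
      apply ih
      refine h1 _ _ (((hA k).pow N).mul hu) ?_
      rw [← mul_assoc, ← pow_succ']
      exact h7
  unfold GoodF
  rw [span_update, h4, h6, h2, ← Finset.mul_prod_erase Finset.univ _ (Finset.mem_univ k),
    Function.update_self, add_zero, mul_assoc]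
  congr 2
  apply Finset.prod_congr rfl
  intro i hi
  rw [Function.update_of_ne (Finset.ne_of_mem_erase hi)]


lemma SopF.vanish {n : ℕ} (w : Fin n → ℕ) {I : Ideal (MvPolynomial (Fin n) ℂ)} (h : SopF I) :
    ∃ T, ∀ t, T ≤ t → ∀ p, IsWeightedHomogeneous w p t → p ∈ I := by
  choose N hN using h
  refine ⟨∑ i, N i * w i + 1, fun t ht p hp => ?_⟩
  rw [p.as_sum]
  refine Ideal.sum_mem _ fun a ha => ?_
  have h1 : ∃ i, N i ≤ a i := by
    by_contra hc
    push Not at hc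
    have h2 := hp (mem_support_iff.mp ha)
    rw [Finsupp.weight_apply, Finsupp.sum_fintype _ _ (by simp)] at h2
    have : ∑ i, a i • w i ≤ ∑ i, N i * w i :=
      Finset.sum_le_sum fun i _ => Nat.mul_le_mul_right _ (hc i).le
    omega
  obtain ⟨i, hi⟩ := h1
  have : monomial a (coeff a p) = monomial (a - Finsupp.single i (N i)) (coeff a p) * X i ^ N i := by
    rw [X_pow_eq_monomial, monomial_mul, mul_one, tsub_add_cancel_of_le]
    simpa using hi
  rw [this]
  exact Ideal.mul_mem_left _ _ (hN i)

lemma hilbF_zero {n : ℕ} {w : Fin n → ℕ} {I : Ideal (MvPolynomial (Fin n) ℂ)} {t : ℕ}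
    (h : ∀ p, IsWeightedHomogeneous w p t → p ∈ I) : hilbF w I t = 0 := by
  have : grPiece w I t = ⊥ := by
    rw [Submodule.eq_bot_iff]
    intro q hq
    obtain ⟨p, hp, rfl⟩ := mem_grPiece.mp hq
    exact Ideal.Quotient.eq_zero_iff_mem.mpr (h p hp)
  rw [hilbF, this, finrank_bot]

lemma hilb_bdd {n : ℕ} {w : Fin n → ℕ} (hw : ∀ i, 0 < w i)
    (J : Ideal (MvPolynomial (Fin n) ℂ))
    (hJ : ∀ p ∈ J, ∀ t, weightedHomogeneousComponent w t p ∈ J)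
    (g : MvPolynomial (Fin n) ℂ) (D : ℕ) (hD : 0 < D) (hg : IsWeightedHomogeneous w g D)
    (hs : SopF (J ⊔ Ideal.span {g})) : ∃ B, ∀ k, hilbF w J (k * D) ≤ B := by
  obtain ⟨T, hT⟩ := hs.vanish w
  refine ⟨∑ j ∈ Finset.range (T + 1), hilbF w J (j * D), fun k => ?_⟩
  induction k with
  | zero =>
    exact Finset.single_le_sum (f := fun j => hilbF w J (j * D)) (fun _ _ => Nat.zero_le _)
      (Finset.mem_range.mpr (Nat.succ_pos T))
  | succ k ih =>
    by_cases hk : k + 1 < T + 1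
    · exact Finset.single_le_sum (f := fun j => hilbF w J (j * D)) (fun _ _ => Nat.zero_le _)
        (Finset.mem_range.mpr hk)
    · obtain ⟨c, hc, -⟩ := hilb_step hw J hJ g D hg (k * D)
      have h0 : hilbF w (J ⊔ Ideal.span {g}) (k * D + D) = 0 := by
        refine hilbF_zero (hT _ ?_)
        nlinarith
      rw [add_mul, one_mul]
      omega

lemma pencil {n : ℕ} {w : Fin n → ℕ} (hw : ∀ i, 0 < w i)
    (J : Ideal (MvPolynomial (Fin n) ℂ))
    (g g' : MvPolynomial (Fin n) ℂ) (D : ℕ) (hg : IsWeightedHomogeneous w g D)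
    (hg' : IsWeightedHomogeneous w g' D)
    (hb : ∃ B, ∀ k, hilbF w J (k * D) ≤ B) :
    ∃ F : Finset ℂ, ∀ l ∉ F, g' ∈ (J ⊔ Ideal.span {g + C l * g'}).radical := by
  obtain ⟨B, hB⟩ := hb
  have := grPiece_fin hw J (B * D)
  let v : Fin (B + 1) → grPiece w J (B * D) := fun j =>
    ⟨Ideal.Quotient.mk J (g ^ (j : ℕ) * g' ^ (B - j)), mem_grPiece.mpr ⟨_, by
      have := (hg.pow (j : ℕ)).mul (hg'.pow (B - j))
      rwa [smul_eq_mul, smul_eq_mul, ← add_mul, Nat.add_sub_cancel' (by omega)] at this, rfl⟩⟩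
  have hv : ¬ LinearIndependent ℂ v := by
    intro h
    have h1 := h.fintype_card_le_finrank
    have h2 := hB B
    unfold hilbF at h2
    rw [Fintype.card_fin] at h1
    omega
  obtain ⟨c, hc, j0, hj0⟩ := Fintype.not_linearIndependent_iff.mp hv
  let P : Polynomial ℂ := ∑ j : Fin (B + 1), Polynomial.monomial (j : ℕ) (c j * (-1) ^ (j : ℕ))
  have hP : P ≠ 0 := by
    intro h
    have := congrArg (fun p => Polynomial.coeff p j0) h
    simp only [P, Polynomial.finsetSum_coeff, Polynomial.coeff_monomial, Polynomial.coeff_zero,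
      Fin.val_inj, Finset.sum_ite_eq', Finset.mem_univ, if_true] at this
    simp [hj0] at this
  refine ⟨P.roots.toFinset, fun l hl => ⟨B, ?_⟩⟩
  have hl : P.eval l ≠ 0 := by
    intro h
    apply hl
    rw [Multiset.mem_toFinset, Polynomial.mem_roots hP]
    exact h
  set K := J ⊔ Ideal.span {g + C l * g'} with hK
  have h1 : ∑ j : Fin (B + 1), C (c j) * (g ^ (j : ℕ) * g' ^ (B - j)) ∈ K := by
    apply (le_sup_left : J ≤ K)
    rw [← Ideal.Quotient.eq_zero_iff_mem, map_sum]
    have := congrArg Subtype.val hc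
    rw [Submodule.coe_sum] at this
    rw [Submodule.coe_zero] at this
    rw [← this]
    refine Finset.sum_congr rfl fun j _ => ?_
    rw [Submodule.coe_smul, ← smul_eq_C_mul]
    rfl
  have h2 : Ideal.Quotient.mk K g = Ideal.Quotient.mk K (C (-l) * g') := by
    rw [Ideal.Quotient.eq]
    have : g - C (-l) * g' = g + C l * g' := by rw [C_neg]; ring
    rw [this]
    exact Ideal.mem_sup_right (Ideal.mem_span_singleton_self _)
  have h3 : C (P.eval l) * g' ^ B ∈ K := by
    rw [← Ideal.Quotient.eq_zero_iff_mem] at h1 ⊢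
    rw [← h1]
    simp only [P, Polynomial.eval_finsetSum, Polynomial.eval_monomial, map_sum, Finset.sum_mul,
      map_mul]
    refine Finset.sum_congr rfl fun j _ => ?_
    rw [map_pow (Ideal.Quotient.mk K) g, h2, ← map_pow, ← map_mul, ← map_mul, ← map_mul]
    have h4 : g' ^ B = g' ^ (j : ℕ) * g' ^ (B - j) := by
      rw [← pow_add, Nat.add_sub_cancel' (by omega)]
    rw [h4]
    simp only [← map_mul]
    congr 1
    simp only [map_neg, map_mul, map_pow, map_one]
    rw [neg_mul, neg_pow (C l * g'), mul_pow]
    ring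
  have h5 : g' ^ B = C (P.eval l)⁻¹ * (C (P.eval l) * g' ^ B) := by
    rw [← mul_assoc, ← C_mul, inv_mul_cancel₀ hl, C_1, one_mul]
  rw [h5]
  exact Ideal.mul_mem_left _ _ h3

lemma pencil_sop {n : ℕ} (J : Ideal (MvPolynomial (Fin n) ℂ)) (g g' a : MvPolynomial (Fin n) ℂ)
    (l : ℂ) (hs : SopF (J ⊔ Ideal.span {a})) (N : ℕ) (ha : a ^ N = g ∨ a ^ N = g')
    (h : g' ∈ (J ⊔ Ideal.span {g + C l * g'}).radical) :
    SopF (J ⊔ Ideal.span {g + C l * g'}) := by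
  set K := J ⊔ Ideal.span {g + C l * g'} with hK
  have h1 : g + C l * g' ∈ K.radical :=
    Ideal.le_radical (Ideal.mem_sup_right (Ideal.mem_span_singleton_self _))
  have h2 : g ∈ K.radical := by
    have : g = (g + C l * g') - C l * g' := by ring
    rw [this]
    exact Ideal.sub_mem _ h1 (Ideal.mul_mem_left _ _ h)
  have h3 : a ^ N ∈ K.radical := by
    rcases ha with ha | ha <;> rw [ha] <;> assumption
  have h4 : a ∈ K.radical := by
    have : a ∈ K.radical.radical := ⟨N, h3⟩
    rwa [Ideal.radical_idem] at this
  have h5 : J ⊔ Ideal.span {a} ≤ K.radical :=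
    sup_le (le_sup_left.trans Ideal.le_radical) (by simpa [Ideal.span_le] using h4)
  intro i
  have := Ideal.radical_mono h5 (hs i)
  rwa [Ideal.radical_idem] at this

lemma update_homog {n : ℕ} {w : Fin n → ℕ} {A : Fin n → MvPolynomial (Fin n) ℂ} {d : Fin n → ℕ}
    (hA : ∀ i, IsWeightedHomogeneous w (A i) (d i)) (k : Fin n) {b : MvPolynomial (Fin n) ℂ} {e : ℕ}
    (hb : IsWeightedHomogeneous w b e) (i : Fin n) :
    IsWeightedHomogeneous w (Function.update A k b i) (Function.update d k e i) := by
  by_cases h : i = k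
  · subst h; simpa using hb
  · simpa [h] using hA i

lemma update_pos' {n : ℕ} {d : Fin n → ℕ} (hd : ∀ i, 0 < d i) (k : Fin n) {e : ℕ} (he : 0 < e)
    (i : Fin n) : 0 < Function.update d k e i := by
  by_cases h : i = k
  · subst h; simpa using he
  · simpa [h] using hd i

lemma GoodF.transfer {n : ℕ} {w : Fin n → ℕ} (hw : ∀ i, 0 < w i) (S : Finset (Fin n)) :
    ∀ (A B : Fin n → MvPolynomial (Fin n) ℂ) (d e : Fin n → ℕ)
    (_ : ∀ i, IsWeightedHomogeneous w (A i) (d i)) (_ : ∀ i, 0 < d i)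
    (_ : ∀ i, IsWeightedHomogeneous w (B i) (e i)) (_ : ∀ i, 0 < e i)
    (_ : SopF (Ideal.span (Set.range A))) (_ : SopF (Ideal.span (Set.range B)))
    (_ : ∀ i ∉ S, A i = B i ∧ d i = e i), GoodF w A d → GoodF w B e := by
  induction S using Finset.induction_on with
  | empty =>
    intro A B d e _ _ _ _ _ _ h hG
    have h1 : A = B := funext fun i => (h i (by simp)).1
    have h2 : d = e := funext fun i => (h i (by simp)).2
    rwa [← h1, ← h2]
  | insert k S hk ih =>
    intro A B d e hA hd hB he sA sB h hG
    set D := d k * e k with hD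
    have hDpos : 0 < D := Nat.mul_pos (hd k) (he k)
    have hg : IsWeightedHomogeneous w (A k ^ e k) D := by
      have := (hA k).pow (e k); rwa [smul_eq_mul, mul_comm] at this
    have hg' : IsWeightedHomogeneous w (B k ^ d k) D := (hB k).pow (d k)
    have sA1 := sA
    have sB1 := sB
    rw [span_eq A k] at sA1
    rw [span_eq B k] at sB1
    have powsop : ∀ (J : Ideal (MvPolynomial (Fin n) ℂ)) (a : MvPolynomial (Fin n) ℂ) (N : ℕ),
        SopF (J ⊔ Ideal.span {a}) → SopF (J ⊔ Ideal.span {a ^ N}) := by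
      intro J a N hs
      have := pencil_sop J (a ^ N) (0) a 0 hs N (Or.inl rfl) (Ideal.zero_mem _)
      simpa using this
    obtain ⟨F1, hF1⟩ := pencil hw _ _ _ D hg hg' (hilb_bdd hw _
      (subIdeal_homog hA (Finset.univ.erase k)) _ D hDpos hg (powsop _ _ _ sA1))
    obtain ⟨F2, hF2⟩ := pencil hw _ _ _ D hg hg' (hilb_bdd hw _
      (subIdeal_homog hB (Finset.univ.erase k)) _ D hDpos hg' (powsop _ _ _ sB1))
    obtain ⟨l, hl⟩ := Infinite.exists_notMem_finset (F1 ∪ F2)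
    rw [Finset.mem_union, not_or] at hl
    have tA := pencil_sop _ _ _ _ l sA1 (e k) (Or.inl rfl) (hF1 l hl.1)
    have tB := pencil_sop _ _ _ _ l sB1 (d k) (Or.inr rfl) (hF2 l hl.2)
    have hz : IsWeightedHomogeneous w (A k ^ e k + C l * B k ^ d k) D := hg.add (hg'.C_mul l)
    set z := A k ^ e k + C l * B k ^ d k
    rw [← span_update] at tA tB
    have G1 := hG.exchange hw hA hd k z D hz tA
    have G2 := ih (Function.update A k z) (Function.update B k z) (Function.update d k D)
      (Function.update e k D) (update_homog hA k hz) (update_pos' hd k hDpos)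
      (update_homog hB k hz) (update_pos' he k hDpos) tA tB (by
        intro i hi
        by_cases hik : i = k
        · subst hik; simp
        · simpa [hik] using h i (by simp [hik, hi])) G1
    have G3 := G2.exchange hw (update_homog hB k hz) (update_pos' he k hDpos) k (B k) (e k) (hB k)
      (by simpa using sB)
    simpa using G3


lemma GoodF_X {n : ℕ} {w : Fin n → ℕ} (hw : ∀ i, 0 < w i) :
    GoodF w (fun i => (X i : MvPolynomial (Fin n) ℂ)) w := by
  unfold GoodF
  rw [← subIdeal_univ]
  generalize (Finset.univ : Finset (Fin n)) = S
  induction S using Finset.induction_on with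
  | empty => simp [subIdeal]
  | insert k S hk ih =>
    obtain ⟨E, -, h1, h2⟩ := hilbS_step hw _
      (subIdeal_homog (A := fun i => (X i : MvPolynomial (Fin n) ℂ))
        (fun i => isWeightedHomogeneous_X ℂ w i) S) (X k) (w k) (isWeightedHomogeneous_X ℂ w k)
    have h3 : E = 0 := by
      rw [h2]
      intro t u hu hku
      unfold subIdeal at hku ⊢
      rw [mem_ideal_span_X_image] at hku ⊢
      intro m hm
      obtain ⟨i, hi, hi2⟩ := hku (Finsupp.single k 1 + m) (by
        rw [mem_support_iff, coeff_X_mul]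
        exact mem_support_iff.mp hm)
      refine ⟨i, hi, ?_⟩
      have : k ≠ i := by rintro rfl; exact hk (by simpa using hi)
      simpa [Finsupp.single_apply, this] using hi2
    rw [subIdeal_insert, h1, h3, ih, Finset.prod_insert hk]
    ring

lemma sop_X {n : ℕ} : SopF (Ideal.span (Set.range (fun i => (X i : MvPolynomial (Fin n) ℂ)))) :=
  fun i => Ideal.le_radical (Ideal.subset_span ⟨i, rfl⟩)

lemma finrank_eq_sum {n : ℕ} {w : Fin n → ℕ} (hw : ∀ i, 0 < w i)
    (I : Ideal (MvPolynomial (Fin n) ℂ))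
    (hI : ∀ p ∈ I, ∀ t, weightedHomogeneousComponent w t p ∈ I) (T : ℕ)
    (hT : ∀ t, T ≤ t → ∀ p, IsWeightedHomogeneous w p t → p ∈ I) :
    Module.finrank ℂ (MvPolynomial (Fin n) ℂ ⧸ I) = ∑ t ∈ Finset.range T, hilbF w I t := by
  have := fun t => grPiece_fin hw I t
  let Φ : ((t : Fin T) → grPiece w I t) →ₗ[ℂ] (MvPolynomial (Fin n) ℂ ⧸ I) :=
    ∑ t : Fin T, (Submodule.subtype (grPiece w I (t : ℕ))).comp (LinearMap.proj t)
  have hΦ : ∀ x, Φ x = ∑ t, (x t : MvPolynomial (Fin n) ℂ ⧸ I) := by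
    intro x; simp [Φ]
  have hinj : Function.Injective Φ := by
    rw [injective_iff_map_eq_zero]
    intro x hx
    rw [hΦ] at hx
    choose p hp hpx using fun t => mem_grPiece.mp (x t).2
    have h1 : ∑ t, p t ∈ I := by
      rw [← Ideal.Quotient.eq_zero_iff_mem, map_sum, ← hx]
      exact Finset.sum_congr rfl fun t _ => hpx t
    ext s
    rw [← hpx s]
    have h2 := hI _ h1 s
    rw [map_sum, Finset.sum_eq_single s] at h2
    · rw [weightedHomogeneousComponent_eq_self (hp s)] at h2
      simpa using Ideal.Quotient.eq_zero_iff_mem.mpr h2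
    · intro t _ hts
      exact (hp t).weightedHomogeneousComponent_ne _ (fun h => hts (Fin.ext h.symm))
    · simp
  have hsurj : Function.Surjective Φ := by
    intro q
    obtain ⟨p, rfl⟩ := Ideal.Quotient.mk_surjective q
    rw [← LinearMap.mem_range, p.as_sum, map_sum]
    refine Submodule.sum_mem _ fun a _ => ?_
    have ha : IsWeightedHomogeneous w (monomial a (coeff a p)) (Finsupp.weight w a) :=
      isWeightedHomogeneous_monomial w a _ rfl
    by_cases hs : Finsupp.weight w a < T
    · refine ⟨Pi.single (⟨Finsupp.weight w a, hs⟩ : Fin T)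
        ⟨_, mem_grPiece.mpr ⟨_, ha, rfl⟩⟩, ?_⟩
      rw [hΦ, Finset.sum_eq_single (⟨Finsupp.weight w a, hs⟩ : Fin T)]
      · simp
      · intro t _ ht
        simp [Pi.single_eq_of_ne ht]
      · simp
    · rw [Ideal.Quotient.eq_zero_iff_mem.mpr (hT _ (by omega) _ ha)]
      exact Submodule.zero_mem _
  rw [← (LinearEquiv.ofBijective Φ ⟨hinj, hsurj⟩).finrank_eq, Module.finrank_pi_fintype,
    Finset.sum_range]
  rfl

lemma hilbS_X {n : ℕ} {w : Fin n → ℕ} :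
    hilbS w (Ideal.span (Set.range (fun i => (X i : MvPolynomial (Fin n) ℂ)))) = 1 := by
  set I := Ideal.span (Set.range (fun i => (X i : MvPolynomial (Fin n) ℂ))) with hI
  have hmem : ∀ p, p ∈ I ↔ constantCoeff p = 0 := by
    intro p
    have : Set.range (fun i => (X i : MvPolynomial (Fin n) ℂ)) = X '' (Set.univ) := by simp
    rw [hI, this, mem_ideal_span_X_image, constantCoeff_eq]
    constructor
    · intro h
      by_contra hc
      obtain ⟨i, -, hi⟩ := h 0 (mem_support_iff.mpr hc)
      simp at hi
    · intro h m hm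
      by_contra hc
      push Not at hc
      have : m = 0 := by ext i; simpa using hc i
      rw [this, mem_support_iff] at hm
      exact hm h
  ext t
  rw [hilbS, PowerSeries.coeff_mk, PowerSeries.coeff_one]
  split_ifs with ht
  · subst ht
    have key : ∀ a : ℂ, a • (1 : MvPolynomial (Fin n) ℂ ⧸ I) = Ideal.Quotient.mk I (C a) := by
      intro a
      have : (C a : MvPolynomial (Fin n) ℂ) = a • 1 := by rw [smul_eq_C_mul, mul_one]
      rw [this]
      rfl
    have h1 : grPiece w I 0 = Submodule.span ℂ {1} := by
      ext q
      rw [mem_grPiece, Submodule.mem_span_singleton]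
      constructor
      · rintro ⟨p, hp, rfl⟩
        refine ⟨constantCoeff p, ?_⟩
        have : Ideal.Quotient.mk I p = Ideal.Quotient.mk I (C (constantCoeff p)) := by
          rw [Ideal.Quotient.eq, hmem]; simp
        rw [this, key]
      · rintro ⟨a, rfl⟩
        refine ⟨C a, isWeightedHomogeneous_C w a, (key a).symm⟩
    have h2 : (1 : MvPolynomial (Fin n) ℂ ⧸ I) ≠ 0 := by
      rw [← map_one (Ideal.Quotient.mk I), Ne, Ideal.Quotient.eq_zero_iff_mem, hmem]
      simp
    rw [hilbF, h1, finrank_span_singleton h2]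
    rfl
  · rw [hilbF_zero]
    · rfl
    · intro p hp
      rw [hmem, constantCoeff_eq]
      apply hp.coeff_eq_zero
      simpa using fun h => ht h.symm

lemma eval_identity {ι : Type*} (s : Finset ι) (w d : ι → ℕ) (P : Polynomial ℤ)
    (h : P * ∏ i ∈ s, (1 - Polynomial.X ^ w i) = ∏ i ∈ s, (1 - Polynomial.X ^ d i)) :
    (∏ i ∈ s, (w i : ℤ)) * P.eval 1 = ∏ i ∈ s, (d i : ℤ) := by
  have hX : (1 - Polynomial.X : Polynomial ℤ) ≠ 0 := by
    intro h0
    have := congrArg (Polynomial.eval 0) h0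
    simp at this
  simp only [← mul_neg_geom_sum, Finset.prod_mul_distrib, Finset.prod_const] at h
  have h2 : P * ∏ i ∈ s, ∑ j ∈ Finset.range (w i), Polynomial.X ^ j =
      ∏ i ∈ s, ∑ j ∈ Finset.range (d i), Polynomial.X ^ j := by
    apply mul_left_cancel₀ (pow_ne_zero s.card hX)
    rw [← h]; ring
  have h3 := congrArg (Polynomial.eval 1) h2
  simp [Polynomial.eval_prod, Polynomial.eval_finsetSum] at h3
  rw [mul_comm]
  exact h3

lemma sop_of_finite {n : ℕ} {w : Fin n → ℕ} (hw : ∀ i, 0 < w i) (I : Ideal (MvPolynomial (Fin n) ℂ))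
    (hI : ∀ p ∈ I, ∀ t, weightedHomogeneousComponent w t p ∈ I)
    [FiniteDimensional ℂ (MvPolynomial (Fin n) ℂ ⧸ I)] : SopF I := by
  intro i
  obtain ⟨q, hq0, hq⟩ := (Algebra.IsIntegral.isIntegral (R := ℂ)
    (Ideal.Quotient.mk I (X i))).isAlgebraic
  have h1 : Polynomial.aeval (X i : MvPolynomial (Fin n) ℂ) q ∈ I := by
    rw [← Ideal.Quotient.eq_zero_iff_mem, ← hq]
    exact (Polynomial.aeval_algHom_apply (Ideal.Quotient.mkₐ ℂ I) (X i) q).symm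
  rw [Polynomial.aeval_eq_sum_range] at h1
  refine ⟨q.natDegree, ?_⟩
  have h2 := hI _ h1 (q.natDegree * w i)
  have hp : ∀ j, IsWeightedHomogeneous w (q.coeff j • (X i : MvPolynomial (Fin n) ℂ) ^ j)
      (j * w i) := by
    intro j
    rw [smul_eq_C_mul]
    exact ((isWeightedHomogeneous_X ℂ w i).pow j).C_mul _
  rw [map_sum, Finset.sum_eq_single q.natDegree] at h2
  · rw [weightedHomogeneousComponent_eq_self (hp _), smul_eq_C_mul] at h2
    have h3 : q.coeff q.natDegree ≠ 0 := by simpa using hq0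
    have h4 := Ideal.mul_mem_left I (C (q.coeff q.natDegree)⁻¹) h2
    rwa [← mul_assoc, ← C_mul, inv_mul_cancel₀ h3, C_1, one_mul] at h4
  · intro j _ hj
    refine (hp j).weightedHomogeneousComponent_ne _ fun h => hj ?_
    exact Nat.eq_of_mul_eq_mul_right (hw i) h.symm
  · simp

lemma core_ci {n : ℕ} {w : Fin n → ℕ} (hw : ∀ i, 0 < w i)
    (A : Fin n → MvPolynomial (Fin n) ℂ) (d : Fin n → ℕ)
    (hA : ∀ i, IsWeightedHomogeneous w (A i) (d i)) (hd : ∀ i, 0 < d i)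
    [FiniteDimensional ℂ (MvPolynomial (Fin n) ℂ ⧸ Ideal.span (Set.range A))] :
    (∏ i, (w i : ℤ)) *
      (Module.finrank ℂ (MvPolynomial (Fin n) ℂ ⧸ Ideal.span (Set.range A)) : ℤ) =
      ∏ i, (d i : ℤ) := by
  have hI : ∀ p ∈ Ideal.span (Set.range A), ∀ t,
      weightedHomogeneousComponent w t p ∈ Ideal.span (Set.range A) := by
    rw [← subIdeal_univ]; exact subIdeal_homog hA _
  have hs : SopF (Ideal.span (Set.range A)) := sop_of_finite hw _ hI
  have hG : GoodF w A d := GoodF.transfer hw Finset.univ _ A w d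
    (fun i => isWeightedHomogeneous_X ℂ w i) hw hA hd sop_X hs (by simp) (GoodF_X hw)
  have hX := GoodF_X hw
  unfold GoodF at hG hX
  rw [hilbS_X] at hX
  obtain ⟨T, hT⟩ := hs.vanish w
  rw [finrank_eq_sum hw _ hI T hT]
  set I := Ideal.span (Set.range A)
  let P : Polynomial ℤ := ∑ t ∈ Finset.range T, Polynomial.monomial t (hilbF w I t : ℤ)
  have hP : (P : PowerSeries ℤ) = hilbS w I := by
    ext t
    rw [Polynomial.coeff_coe, hilbS, PowerSeries.coeff_mk]
    simp only [P, Polynomial.finsetSum_coeff, Polynomial.coeff_monomial, Finset.sum_ite_eq',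
      Finset.mem_range]
    split_ifs with h
    · rfl
    · rw [hilbF_zero (hT t (by omega))]; rfl
  have h1 : P * ∏ i, (1 - Polynomial.X ^ w i) = ∏ i, (1 - Polynomial.X ^ d i) := by
    apply Polynomial.coe_injective ℤ
    have e : ∀ v : Fin n → ℕ, ((∏ i, (1 - Polynomial.X ^ v i) : Polynomial ℤ) : PowerSeries ℤ) =
        ∏ i, (1 - PowerSeries.X ^ v i) := by
      intro v
      rw [← Polynomial.coeToPowerSeries.ringHom_apply, map_prod]
      simp
    rw [Polynomial.coe_mul, e, e, hP, hG]
    linear_combination -(∏ i, (1 - (PowerSeries.X : PowerSeries ℤ) ^ d i)) * hX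
  have h2 := eval_identity Finset.univ w d P h1
  rw [← h2]
  congr 1
  simp [P, Polynomial.eval_finsetSum]

/-- If `h` is weighted homogeneous of weighted degree `m` for positive weights `w i`
and its Milnor algebra is finite dimensional over `ℂ`, then
`(∏ i, w i) * dim_ℂ Q(h) = ∏ i, (m - w i)` as integers. -/
theorem milnor_number_weighted_homogeneous (n : ℕ) (hn : 1 ≤ n)
    (m : ℕ) (hm : 0 < m) (w : Fin n → ℕ) (hw : ∀ i, 0 < w i)
    (h : MvPolynomial (Fin n) ℂ)
    (hwh : MvPolynomial.IsWeightedHomogeneous w h m)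
    [FiniteDimensional ℂ (milnorAlgebra n h)] :
    (∏ i, (w i : ℤ)) * (Module.finrank ℂ (milnorAlgebra n h) : ℤ) =
      ∏ i, ((m : ℤ) - (w i : ℤ)) := by
  have hz : ∀ i, m < w i → pderiv i h = 0 := by
    intro i hi
    apply pderiv_eq_zero_of_notMem_vars
    rw [mem_vars_iff_mem_support]
    rintro ⟨a, ha, hai⟩
    have h1 := hwh (mem_support_iff.mp ha)
    have h2 := Finsupp.le_weight_of_ne_zero' w (Finsupp.mem_support_iff.mp hai)
    omega
  by_cases hu : ∃ i, m = w i ∧ pderiv i h ≠ 0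
  · obtain ⟨i, hi, hne⟩ := hu
    have h0 : IsWeightedHomogeneous w (pderiv i h) 0 := hwh.pderiv (by omega)
    have h1 := weightedHomogeneousComponent_eq_self h0
    have hmem : pderiv i h ∈ jacobianIdeal n h := Ideal.subset_span ⟨i, rfl⟩
    rw [weightedHomogeneousComponent_zero _ (fun i => (hw i).ne')] at h1
    have htop : jacobianIdeal n h = ⊤ := by
      apply Ideal.eq_top_of_isUnit_mem _ hmem
      rw [← h1]
      apply IsUnit.map
      rw [isUnit_iff_ne_zero]
      intro h2
      rw [h2, C_0] at h1
      exact hne h1.symm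
    have : Subsingleton (milnorAlgebra n h) := Ideal.Quotient.subsingleton_iff.mpr htop
    have hp : ∏ i, ((m : ℤ) - (w i : ℤ)) = 0 :=
      Finset.prod_eq_zero (Finset.mem_univ i) (by rw [hi]; ring)
    rw [Module.finrank_zero_of_subsingleton, hp]
    simp
  · push Not at hu
    have hlt : ∀ i, pderiv i h ≠ 0 → w i < m := by
      intro i hi
      by_contra hc
      rcases Nat.lt_or_ge m (w i) with h1 | h1
      · exact hi (hz i h1)
      · exact hi (hu i (by omega))
    classical
    let d : Fin n → ℕ := fun i => if pderiv i h = 0 then 1 else m - w i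
    have hd : ∀ i, 0 < d i := by
      intro i
      simp only [d]
      split_ifs with h1
      · exact Nat.one_pos
      · have := hlt i h1
        omega
    have hA : ∀ i, IsWeightedHomogeneous w (pderiv i h) (d i) := by
      intro i
      simp only [d]
      split_ifs with h1
      · rw [h1]; exact isWeightedHomogeneous_zero ℂ w 1
      · have := hlt i h1
        exact hwh.pderiv (by omega)
    have : FiniteDimensional ℂ
        (MvPolynomial (Fin n) ℂ ⧸ Ideal.span (Set.range fun i => pderiv i h)) :=
      inferInstanceAs (FiniteDimensional ℂ (milnorAlgebra n h))
    have key := core_ci hw (fun i => pderiv i h) d hA hd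
    by_cases hall : ∀ i, pderiv i h ≠ 0
    · refine key.trans (Finset.prod_congr rfl fun i _ => ?_)
      have := hlt i (hall i)
      simp only [d, if_neg (hall i)]
      omega
    · exfalso
      push Not at hall
      obtain ⟨j, hj⟩ := hall
      have key2 := core_ci hw (fun i => pderiv i h) (Function.update d j 2)
        (by
          intro i
          by_cases hij : i = j
          · subst hij
            simp only [hj]
            exact isWeightedHomogeneous_zero ℂ w _
          · simpa [hij] using hA i)
        (update_pos' hd j (by norm_num))
      rw [key] at key2
      rw [← Finset.mul_prod_erase Finset.univ _ (Finset.mem_univ j),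
        ← Finset.mul_prod_erase Finset.univ (fun i => ((Function.update d j 2 i : ℕ) : ℤ))
          (Finset.mem_univ j)] at key2
      have h1 : ∏ i ∈ Finset.univ.erase j, ((Function.update d j 2 i : ℕ) : ℤ) =
          ∏ i ∈ Finset.univ.erase j, (d i : ℤ) :=
        Finset.prod_congr rfl fun i hi => by
          rw [Function.update_of_ne (Finset.ne_of_mem_erase hi)]
      have h2 : 0 < ∏ i ∈ Finset.univ.erase j, (d i : ℤ) :=
        Finset.prod_pos fun i _ => by exact_mod_cast hd i
      have h3 : d j = 1 := by simp [d, hj]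
      rw [h1, h3, Function.update_self] at key2
      push_cast at key2
      linarith
end

section
/- Let n ≥ 3 and d ≥ 3 be integers and let f ∈ ℂ[x_1, …, x_n] be a nonzero homogeneous polynomial of degree d. Let (∂f) denote the ideal generated by the partial derivatives ∂f/∂x_1, …, ∂f/∂x_n, and assume the Krull dimension of the Jacobian ring ℂ[x_1, …, x_n]/(∂f) is at most 1 (which holds when the projective hypersurface {f = 0} ⊂ ℙ^{n−1} has only isolated singularities). Then there is no homogeneous polynomial g of degree d−2 such that the ℂ-linear span of {∂f/∂x_1, …, ∂f/∂x_n} equals the ℂ-linear span of {x_1·g, …, x_n·g}; that is, the degree-(d−1) graded piece (∂f)_{d−1} is not of the form R_1·g for any g ∈ R_{d−2}. -/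
open MvPolynomial

noncomputable section
def killVars (n k : ℕ) : MvPolynomial (Fin n) ℂ →ₐ[ℂ] MvPolynomial (Fin n) ℂ :=
  aeval (fun i : Fin n => if i.1 < k then 0 else X i)

lemma killVars_mono (n k : ℕ) :
    RingHom.ker (killVars n k) ≤ RingHom.ker (killVars n (k+1)) := by
  intro p hp
  have h : (killVars n (k+1)) = (killVars n (k+1)).comp (killVars n k) := by
    apply MvPolynomial.algHom_ext
    intro i
    by_cases h : i.1 < k
    · have h' : i.1 ≤ k := by omega
      simp [killVars, h, h']
    · simp [killVars, h]
  rw [RingHom.mem_ker] at hp ⊢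
  rw [h, AlgHom.comp_apply, hp, map_zero]

lemma killVars_height (n k : ℕ) (hk : k ≤ n) :
    (k : ℕ∞) ≤ (RingHom.ker (killVars n k)).height := by
  induction k with
  | zero => simp
  | succ k ih =>
    have hp : (RingHom.ker (killVars n k)).IsPrime := RingHom.ker_isPrime _
    have hp : (RingHom.ker (killVars n (k+1))).IsPrime := RingHom.ker_isPrime _
    have hlt : RingHom.ker (killVars n k) < RingHom.ker (killVars n (k+1)) := by
      refine lt_of_le_of_ne (killVars_mono n k) fun he => ?_
      have h1 : (X ⟨k, hk⟩ : MvPolynomial (Fin n) ℂ) ∈ RingHom.ker (killVars n (k+1)) := by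
        simp [RingHom.mem_ker, killVars]
      rw [← he] at h1
      simp [RingHom.mem_ker, killVars] at h1
    have h2 := Ideal.height_add_one_le_of_lt_of_isPrime hlt
    push_cast
    exact le_trans (by gcongr; exact ih (by omega)) h2

end

/-- Let `f` be a nonzero homogeneous polynomial of degree `d ≥ 3` in `n ≥ 3` variables
whose Jacobian ring `R/(∂f)` has Krull dimension at most `1`. Then the span of the
partial derivatives of `f` is not of the form `R₁·g` for a homogeneous polynomial `g`
of degree `d - 2`. -/
theorem jacobian_piece_not_principal_times_linear (n d : ℕ) (hn : 3 ≤ n) (hd : 3 ≤ d)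
    (f : MvPolynomial (Fin n) ℂ) (hf0 : f ≠ 0) (hf : f.IsHomogeneous d)
    (hkrull : ringKrullDim
        (MvPolynomial (Fin n) ℂ ⧸
          Ideal.span (Set.range fun i => MvPolynomial.pderiv i f)) ≤ 1) :
    ¬ ∃ g : MvPolynomial (Fin n) ℂ, g.IsHomogeneous (d - 2) ∧
        Submodule.span ℂ (Set.range fun i => MvPolynomial.pderiv i f) =
          Submodule.span ℂ (Set.range fun i => MvPolynomial.X i * g) := by
  rintro ⟨g, hg, hspan⟩
  have hp : (RingHom.ker (killVars n n)).IsPrime := RingHom.ker_isPrime _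
  have hmem : g ∈ RingHom.ker (killVars n n) := by
    have h0 : constantCoeff g = 0 := by
      rw [constantCoeff_eq]
      apply hg.coeff_eq_zero
      simp
      omega
    have : killVars n n = aeval (0 : Fin n → MvPolynomial (Fin n) ℂ) := by
      apply MvPolynomial.algHom_ext
      intro i
      simp [killVars]
    rw [RingHom.mem_ker, this, aeval_zero, h0, map_zero]
  have h1 := Ideal.height_le_ringKrullDim_quotient_add_one hmem
  have h2 := killVars_height n n le_rfl
  have hle : Ideal.span (Set.range fun i => MvPolynomial.pderiv i f) ≤ Ideal.span {g} := by
    rw [Ideal.span_le]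
    rintro _ ⟨i, rfl⟩
    have hi : pderiv i f ∈ Submodule.span ℂ (Set.range fun i => X i * g) := by
      rw [← hspan]
      exact Submodule.subset_span ⟨i, rfl⟩
    have hle' : Submodule.span ℂ (Set.range fun i : Fin n => X i * g) ≤
        (Ideal.span {g}).restrictScalars ℂ := by
      rw [Submodule.span_le]
      rintro _ ⟨j, rfl⟩
      exact Ideal.mul_mem_left _ _ (Ideal.mem_span_singleton_self g)
    exact hle' hi
  have h3 := ringKrullDim_le_of_surjective (Ideal.Quotient.factor hle)
    (Ideal.Quotient.factor_surjective hle)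
  have h4 : ((3 : ℕ∞) : WithBot ℕ∞) ≤ 1 + 1 := by
    refine le_trans ?_ (h1.trans (add_le_add_left (h3.trans hkrull) 1))
    exact WithBot.coe_le_coe.mpr (le_trans (by exact_mod_cast hn) h2)
  have h5 : ((3 : ℕ) : ℕ∞) ≤ ((2 : ℕ) : ℕ∞) := by
    have : ((3 : ℕ∞) : WithBot ℕ∞) ≤ ((2 : ℕ∞) : WithBot ℕ∞) := h4
    exact WithBot.coe_le_coe.mp this
  rw [Nat.cast_le] at h5
  omega
end

section
/- Let n ≥ 1 and e ≥ 0 be integers and let W be a ℂ-linear subspace of the space R_e of homogeneous polynomials of degree e in ℂ[x_1, …, x_n] with dim_ℂ W ≥ 2. Then the ℂ-linear span of {x_i·w : 1 ≤ i ≤ n, w ∈ W} inside R_{e+1} has dimension at least n + 1. (Consequently, for a graded ideal I ⊆ R containing the Jacobian ideal of a homogeneous polynomial of degree d, dim I_{d−1} > n whenever dim I_{d−2} > 1.) -/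
open MvPolynomial

lemma aux_eval {n : ℕ} (a : Fin n → ℂ) (k : Fin n) :
    MvPolynomial.eval (Pi.single k (1:ℂ)) (∑ i, a i • (X i : MvPolynomial (Fin n) ℂ)) = a k := by
  simp [MvPolynomial.smul_eval, Pi.single_apply]

/-- If `W` is a subspace of the space of homogeneous polynomials of degree `e` in
`n ≥ 1` variables with `dim_ℂ W ≥ 2`, then the span of `{x_i · w : 1 ≤ i ≤ n, w ∈ W}`
has dimension at least `n + 1`. -/
theorem span_shift_dim_ge (n e : ℕ) (hn : 1 ≤ n)
    (W : Submodule ℂ (MvPolynomial (Fin n) ℂ))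
    (hW : W ≤ MvPolynomial.homogeneousSubmodule (Fin n) ℂ e)
    (hdim : 2 ≤ Module.rank ℂ W) :
    (n + 1 : Cardinal) ≤ Module.rank ℂ
      (Submodule.span ℂ
        {p : MvPolynomial (Fin n) ℂ | ∃ i : Fin n, ∃ w ∈ W, p = MvPolynomial.X i * w}) := by
  by_contra hlt
  set S := Submodule.span ℂ
        {p : MvPolynomial (Fin n) ℂ | ∃ i : Fin n, ∃ w ∈ W, p = MvPolynomial.X i * w} with hS
  have hlt' : Module.rank ℂ S < ((n + 1 : ℕ) : Cardinal) := by
    push_cast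
    exact not_le.mp hlt
  have hfin : Module.Finite ℂ S :=
    Module.rank_lt_aleph0_iff.mp (hlt'.trans (Cardinal.natCast_lt_aleph0))
  have hfr : Module.finrank ℂ S ≤ n := by
    rw [← Module.finrank_eq_rank] at hlt'
    have := Nat.cast_lt.mp hlt'
    omega
  have key : ∀ f ∈ W, f ≠ 0 → ∀ g ∈ W, ∃ c : ℂ, c • f = g := by
    intro f hf hf0 g hg
    have hli : LinearIndependent ℂ (fun i : Fin n => (X i : MvPolynomial (Fin n) ℂ) * f) := by
      rw [Fintype.linearIndependent_iff]
      intro a ha k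
      have h1 : (∑ i, a i • (X i : MvPolynomial (Fin n) ℂ)) * f = 0 := by
        rw [Finset.sum_mul, ← ha]
        simp only [smul_mul_assoc]
      have h2 := (mul_eq_zero.mp h1).resolve_right hf0
      rw [← aux_eval a k, h2, map_zero]
    have hle : Submodule.span ℂ (Set.range (fun i : Fin n => (X i : MvPolynomial (Fin n) ℂ) * f)) ≤ S := by
      rw [Submodule.span_le]
      rintro _ ⟨i, rfl⟩
      exact Submodule.subset_span ⟨i, f, hf, rfl⟩
    have heq := Submodule.eq_of_le_of_finrank_le hle (by
      rw [finrank_span_eq_card hli]; simpa using hfr)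
    have hl : ∀ i : Fin n, ∃ a : Fin n → ℂ,
        (∑ k, a k • (X k : MvPolynomial (Fin n) ℂ)) * f = X i * g := by
      intro i
      have : X i * g ∈ S := Submodule.subset_span ⟨i, g, hg, rfl⟩
      rw [← heq, Submodule.mem_span_range_iff_exists_fun] at this
      obtain ⟨a, ha⟩ := this
      refine ⟨a, ?_⟩
      rw [← ha, Finset.sum_mul]
      simp only [smul_mul_assoc]
    choose a ha using hl
    let z : Fin n := ⟨0, hn⟩
    have hz : ∀ k, k ≠ z → a z k = 0 := by
      intro k hk
      have h1 : (X k : MvPolynomial (Fin n) ℂ) * (∑ j, a z j • X j)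
          = X z * (∑ j, a k j • X j) := by
        apply mul_right_cancel₀ hf0
        rw [mul_assoc, mul_assoc, ha, ha]
        ring
      have h2 := congrArg (MvPolynomial.eval (Pi.single k (1:ℂ))) h1
      rw [map_mul, map_mul, aux_eval, aux_eval] at h2
      simpa [Pi.single_apply, hk.symm] using h2
    refine ⟨a z z, ?_⟩
    apply mul_left_cancel₀ (MvPolynomial.X_ne_zero (R := ℂ) z)
    rw [← ha z, Finset.sum_eq_single z (fun k _ hk => by rw [hz k hk, zero_smul]) (by simp)]
    simp only [smul_mul_assoc, mul_smul_comm]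
  have h1 : Module.rank ℂ W ≤ 1 := by
    rw [rank_le_one_iff]
    by_cases h : ∃ f ∈ W, f ≠ 0
    · obtain ⟨f, hf, hf0⟩ := h
      refine ⟨⟨f, hf⟩, fun v => ?_⟩
      obtain ⟨c, hc⟩ := key f hf hf0 v v.2
      exact ⟨c, Subtype.ext hc⟩
    · push Not at h
      exact ⟨0, fun v => ⟨0, Subtype.ext (by simp [h v v.2])⟩⟩
  have h2 := hdim.trans h1
  exact absurd h2 (by norm_num)
end
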